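/- For every n ≥ 3 and all cycle nodes i, j with 1 ≤ i, j ≤ n−1, the write quorums of the wheel protocol satisfy the minimality (antichain) property: if W_i ⊆ W_j then W_i = W_j; in particular no write quorum is a proper subset of another write quorum. -/

import Mathlib

/-- Write quorum of the wheel protocol on `n` nodes starting at cycle node `i`:
the HUB `0` together with `⌈(n-1)/2⌉` alternating cycle nodes starting at `i`. -/
def writeQuorum (n i : ℕ) : Finset ℕ :=
  {0} ∪ (Finset.range ((n - 1 + 1) / 2)).image (fun k => ((i - 1 + 2 * k) % (n - 1)) + 1)

/-- All write quorums have the same size: the hub and `⌈(n-1)/2⌉` distinct cycle nodes. -/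
theorem card_writeQuorum (n i : ℕ) : (writeQuorum n i).card = 1 + (n - 1 + 1) / 2 := by
  unfold writeQuorum
  rw [Finset.card_union_of_disjoint (by simp), Finset.card_singleton,
    Finset.card_image_of_injOn, Finset.card_range]
  intro a ha b hb hab
  rw [Finset.mem_coe, Finset.mem_range] at ha hb
  have hmod : i - 1 + 2 * a ≡ i - 1 + 2 * b [MOD n - 1] := Nat.succ.inj hab
  have h := (Nat.ModEq.add_left_cancel' _ hmod).eq_of_lt_of_lt (by omega) (by omega)
  omega

/-- Minimality (antichain) property of write quorums:
if `W_i ⊆ W_j` then `W_i = W_j`; no write quorum is a proper subset of another. -/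
theorem writeQuorum_antichain (n i j : ℕ) (hn : 3 ≤ n)
    (hi1 : 1 ≤ i) (hi2 : i ≤ n - 1) (hj1 : 1 ≤ j) (hj2 : j ≤ n - 1)
    (hsub : writeQuorum n i ⊆ writeQuorum n j) :
    writeQuorum n i = writeQuorum n j :=
  Finset.eq_of_subset_of_card_le hsub (by rw [card_writeQuorum, card_writeQuorum])
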